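/- arXiv:2108.06469 — 3 statements merged into one kernel-verified Lean document; each statement's English description precedes it below -/
import Mathlib

section
/- Let k > 0 and let μ belong to the set M := {nπ : n ∈ ℕ₀} ∪ {(n + 1/2)π : n ∈ ℕ₀}. (i) If μ < k, then with λ := √(1 − μ²/k²), [1 + (1 − λ²)·(sin(2kλ)/(2kλ))] / [(1 − λ²)·cos²(kλ) + λ²] ≤ 6·max{k², 1}. (ii) If μ > k, then with λ := √(μ²/k² − 1), 2·[(sinh(2kλ)/(2kλ))·(1 + λ²) + 1] / [(λ² + 1)·cosh(2kλ) + 1 − λ²] ≤ 3. -/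
open scoped Real

theorem Real.sinh_le_mul_cosh {y : ℝ} (hy : 0 < y) : Real.sinh y ≤ y * Real.cosh y := by
  obtain ⟨c, hc, h⟩ := exists_deriv_eq_slope Real.sinh hy
    Real.continuous_sinh.continuousOn Real.differentiable_sinh.differentiableOn
  have hle : Real.cosh c ≤ Real.cosh y := by
    rw [Real.cosh_le_cosh, abs_of_pos hc.1, abs_of_pos hy]
    exact hc.2.le
  rw [Real.deriv_sinh, Real.sinh_zero, sub_zero, sub_zero, eq_div_iff hy.ne'] at h
  nlinarith

theorem Real.one_add_two_mul_sq_le_cosh_two_mul {x : ℝ} (hx : 0 ≤ x) :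
    1 + 2 * x ^ 2 ≤ Real.cosh (2 * x) := by
  have h := Real.self_le_sinh_iff.2 hx
  have h2 := Real.cosh_sq x
  rw [Real.cosh_two_mul]
  nlinarith

theorem eq_zero_or_three_halves_lt_of_half_multiple_pi {μ : ℝ}
    (hμ : ∃ n : ℕ, μ = (n : ℝ) * π ∨ μ = ((n : ℝ) + 1 / 2) * π) :
    μ = 0 ∨ 3 / 2 < μ := by
  have hpi := Real.pi_gt_three
  obtain ⟨n, rfl | rfl⟩ := hμ
  · rcases Nat.eq_zero_or_pos n with rfl | hn
    · simp
    · have : (1 : ℝ) ≤ n := by exact_mod_cast hn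
      right
      nlinarith
  · have : (0 : ℝ) ≤ n := n.cast_nonneg
    right
    nlinarith

/-- The propagating bound, for any wave number at least `1` in the transverse direction. -/
theorem propagating_mode_le {k μ l : ℝ} (hk : 0 < k) (hμ : 1 ≤ μ ^ 2) (hl : 0 < l)
    (h : k ^ 2 * (1 - l ^ 2) = μ ^ 2) :
    (1 + (1 - l ^ 2) * (Real.sin (2 * k * l) / (2 * k * l)))
        / ((1 - l ^ 2) * Real.cos (k * l) ^ 2 + l ^ 2) ≤ 2 * k ^ 2 := by
  have hx : 0 < k * l := mul_pos hk hl
  have hk2 : 0 < k ^ 2 := by positivity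
  have hl1 : 0 ≤ 1 - l ^ 2 := by
    by_contra! hneg
    nlinarith
  have hsinc : Real.sin (2 * k * l) / (2 * k * l) ≤ 1 := by
    rw [div_le_one (by positivity)]
    exact Real.sin_le (by positivity)
  have hsin : Real.sin (k * l) ^ 2 ≤ (k * l) ^ 2 := Real.sin_sq_le_sq
  have hden : 1 ≤ k ^ 2 * ((1 - l ^ 2) * Real.cos (k * l) ^ 2 + l ^ 2) := by
    have hsc := Real.sin_sq_add_cos_sq (k * l)
    calc 1 ≤ μ ^ 2 * Real.cos (k * l) ^ 2 + (k * l) ^ 2 := by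
          nlinarith [sq_nonneg (Real.cos (k * l))]
      _ = _ := by rw [← h]; ring
  have hpos : 0 < (1 - l ^ 2) * Real.cos (k * l) ^ 2 + l ^ 2 := by positivity
  rw [div_le_iff₀ hpos]
  nlinarith [mul_le_mul_of_nonneg_left hsinc hl1, sq_nonneg l]

/-- The evanescent bound, for any wave number at least `√2` in the transverse direction. -/
theorem evanescent_mode_le {k μ l : ℝ} (hk : 0 < k) (hμ : 2 ≤ μ ^ 2) (hl : 0 < l)
    (h : k ^ 2 * (1 + l ^ 2) = μ ^ 2) :
    2 * ((Real.sinh (2 * k * l) / (2 * k * l)) * (1 + l ^ 2) + 1)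
        / ((l ^ 2 + 1) * Real.cosh (2 * k * l) + 1 - l ^ 2) ≤ 3 := by
  have hs : Real.sinh (2 * k * l) / (2 * k * l) ≤ Real.cosh (2 * k * l) := by
    rw [div_le_iff₀ (by positivity), mul_comm (Real.cosh _)]
    exact Real.sinh_le_mul_cosh (by positivity)
  have hc : 1 + 2 * (k * l) ^ 2 ≤ Real.cosh (2 * k * l) := by
    rw [mul_assoc]
    exact Real.one_add_two_mul_sq_le_cosh_two_mul (by positivity)
  have hl1 : 0 < 1 + l ^ 2 := by positivity
  have hcl : (1 + l ^ 2) * (1 + 2 * (k * l) ^ 2) ≤ (1 + l ^ 2) * Real.cosh (2 * k * l) :=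
    mul_le_mul_of_nonneg_left hc hl1.le
  have hsl := mul_le_mul_of_nonneg_left hs hl1.le
  have hkl : 2 * l ^ 2 ≤ (1 + l ^ 2) * (k * l) ^ 2 := by
    calc 2 * l ^ 2 ≤ μ ^ 2 * l ^ 2 := by gcongr
      _ = _ := by rw [← h]; ring
  have hpos : 0 < (l ^ 2 + 1) * Real.cosh (2 * k * l) + 1 - l ^ 2 := by
    nlinarith [sq_nonneg l]
  rw [div_le_iff₀ hpos]
  nlinarith [sq_nonneg l]

/-- Per-mode bounds `φₙ ≤ 6·max{k²,1}` (propagating) and `ψₙ ≤ 3` (evanescent) for the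
impedance–Neumann boundary configuration. -/
theorem stmt_9 (k μ : ℝ) (hk : 0 < k)
    (hμ : ∃ n : ℕ, μ = (n : ℝ) * π ∨ μ = ((n : ℝ) + 1 / 2) * π) :
    (∀ l : ℝ, μ < k → l = Real.sqrt (1 - μ ^ 2 / k ^ 2) →
      (1 + (1 - l ^ 2) * (Real.sin (2 * k * l) / (2 * k * l)))
        / ((1 - l ^ 2) * Real.cos (k * l) ^ 2 + l ^ 2)
      ≤ 6 * max (k ^ 2) 1)
    ∧ (∀ l : ℝ, k < μ → l = Real.sqrt (μ ^ 2 / k ^ 2 - 1) →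
      2 * ((Real.sinh (2 * k * l) / (2 * k * l)) * (1 + l ^ 2) + 1)
        / ((l ^ 2 + 1) * Real.cosh (2 * k * l) + 1 - l ^ 2)
      ≤ 3) := by
  have hμ' := eq_zero_or_three_halves_lt_of_half_multiple_pi hμ
  refine ⟨fun l hlt hl => ?_, fun l hlt hl => ?_⟩
  · rcases hμ' with rfl | hμ'
    · obtain rfl : l = 1 := by simpa using hl
      have := le_max_right (k ^ 2) 1
      norm_num
      linarith
    · have hpos : 0 < 1 - μ ^ 2 / k ^ 2 := by
        rw [sub_pos, div_lt_one (by positivity)]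
        nlinarith
      have hl2 : l ^ 2 = 1 - μ ^ 2 / k ^ 2 := by rw [hl, Real.sq_sqrt hpos.le]
      have hl0 : 0 < l := hl ▸ Real.sqrt_pos.2 hpos
      refine (propagating_mode_le hk (by nlinarith) hl0 (μ := μ) ?_).trans ?_
      · rw [hl2]
        field_simp
        ring
      · nlinarith [le_max_left (k ^ 2) 1, sq_nonneg k]
  · have hμ0 : 3 / 2 < μ := hμ'.resolve_left (hk.trans hlt).ne'
    have hpos : 0 < μ ^ 2 / k ^ 2 - 1 := by
      rw [sub_pos, one_lt_div (by positivity)]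
      nlinarith
    have hl2 : l ^ 2 = μ ^ 2 / k ^ 2 - 1 := by rw [hl, Real.sq_sqrt hpos.le]
    have hl0 : 0 < l := hl ▸ Real.sqrt_pos.2 hpos
    refine evanescent_mode_le hk (by nlinarith) hl0 (μ := μ) ?_
    rw [hl2]
    field_simp
    ring
end

section
/- Let k > 0 and let μ belong to the set M := {nπ : n ∈ ℕ₀} ∪ {(n + 1/2)π : n ∈ ℕ₀}. (i) If μ < k, then with λ := √(1 − μ²/k²), [(1 + λ²) − (sin(2kλ)/(2kλ))·(1 − λ²)²] / [λ²·((1 − λ²)·cos²(kλ) + λ²)] ≤ 10·max{k⁴, 1}. (ii) If μ > k, then with λ := √(μ²/k² − 1), 2·[(1 + λ²)²·(sinh(2kλ)/(2kλ)) + (λ² − 1)] / [λ²·((λ² + 1)·(cosh(2kλ) − 1) + 2)] ≤ 10·max{k², 1}. -/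
open scoped Real

theorem sinh_le_self_mul_cosh {x : ℝ} (hx : 0 ≤ x) : Real.sinh x ≤ x * Real.cosh x := by
  have hmono : MonotoneOn (fun t : ℝ => t * Real.cosh t - Real.sinh t) (Set.Ici 0) := by
    apply monotoneOn_of_deriv_nonneg (convex_Ici 0) (by fun_prop) (by fun_prop)
    intro t ht
    rw [interior_Ici] at ht
    have hd : HasDerivAt (fun t : ℝ => t * Real.cosh t - Real.sinh t)
        (1 * Real.cosh t + t * Real.sinh t - Real.cosh t) t :=
      ((hasDerivAt_id t).mul (Real.hasDerivAt_cosh t)).sub (Real.hasDerivAt_sinh t)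
    rw [hd.deriv]
    have := mul_nonneg (le_of_lt ht) (Real.sinh_nonneg_iff.2 (le_of_lt ht))
    linarith
  have := hmono (Set.mem_Ici.2 le_rfl) (Set.mem_Ici.2 hx) hx
  simp at this
  linarith

theorem one_sub_sq_le_sin_two_mul_div {x : ℝ} (hx : 0 < x) (hx1 : x ≤ 1) :
    1 - 2 / 3 * x ^ 2 ≤ Real.sin (2 * x) / (2 * x) := by
  rw [le_div_iff₀ (by positivity), Real.sin_two_mul]
  have hs := Real.sin_gt_sub_cube hx
  have hc := Real.one_sub_sq_div_two_le_cos (x := x)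
  have hx2 : x ^ 2 ≤ 1 := by nlinarith
  have h3 : (x - x ^ 3 / 6) * (1 - x ^ 2 / 2) ≤ Real.sin x * Real.cos x := by
    apply mul_le_mul hs.le hc (by linarith)
    exact Real.sin_nonneg_of_nonneg_of_le_pi hx.le (by linarith [Real.pi_gt_three])
  have : 0 ≤ x ^ 5 := by positivity
  nlinarith

theorem sinh_two_mul_div_le {x : ℝ} (hx : 0 < x) (hx1 : x ≤ 1) :
    Real.sinh (2 * x) / (2 * x) ≤ 1 + 2 * x ^ 2 := by
  have hx2 : x ^ 2 ≤ 1 := by nlinarith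
  have hsc := sinh_le_self_mul_cosh hx.le
  have hc := Real.cosh_le_exp_half_sq x
  have hc0 := Real.cosh_pos x
  have he : Real.exp (x ^ 2 / 2) * Real.exp (x ^ 2 / 2) = Real.exp (x ^ 2) := by
    rw [← Real.exp_add]; ring_nf
  have hb := Real.abs_exp_sub_one_le (x := x ^ 2) (by rwa [abs_of_nonneg (sq_nonneg x)])
  rw [abs_of_nonneg (sq_nonneg x)] at hb
  have hcc : Real.cosh x * Real.cosh x ≤ 1 + 2 * x ^ 2 := by
    have := mul_le_mul hc hc hc0.le (Real.exp_pos _).le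
    linarith [le_abs_self (Real.exp (x ^ 2) - 1)]
  rw [div_le_iff₀ (by positivity), Real.sinh_two_mul]
  have h1 := mul_le_mul_of_nonneg_right hsc hc0.le
  have h2 := mul_le_mul_of_nonneg_left hcc hx.le
  linarith

theorem sinh_two_mul_le_cosh_two_mul {x : ℝ} (hx : 1 ≤ x) :
    Real.sinh (2 * x) ≤ 2 * (Real.cosh (2 * x) - 1) := by
  have h1 := Real.add_one_le_exp (2 * x)
  have h2 : Real.exp (2 * x) * Real.exp (-(2 * x)) = 1 := by
    rw [← Real.exp_add]; simp
  rw [Real.sinh_eq, Real.cosh_eq]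
  have h3 := Real.exp_pos (-(2 * x))
  nlinarith [mul_nonneg (by linarith : 0 ≤ Real.exp (2 * x) - 3)
    (by linarith : 0 ≤ Real.exp (2 * x) - 1)]

theorem propagating_mode_bound {k l : ℝ} (hk : 0 < k) (hk2 : 2 ≤ k ^ 2) (hl : 0 < l)
    (hl1 : l ≤ 1) :
    ((1 + l ^ 2) - (Real.sin (2 * k * l) / (2 * k * l)) * (1 - l ^ 2) ^ 2)
        / (l ^ 2 * ((1 - l ^ 2) * Real.cos (k * l) ^ 2 + l ^ 2)) ≤ 10 * k ^ 4 := by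
  have hl2 : l ^ 2 ≤ 1 := by nlinarith
  have hlp : 0 < l ^ 2 := by positivity
  have hx : 0 < k * l := by positivity
  have hcos : 0 ≤ (1 - l ^ 2) * Real.cos (k * l) ^ 2 :=
    mul_nonneg (by linarith) (sq_nonneg _)
  rw [div_le_iff₀ (by positivity), mul_assoc 2 k l]
  rcases le_total (k * l) 1 with h | h
  · have hs := one_sub_sq_le_sin_two_mul_div hx h
    have hc := Real.one_sub_sq_div_two_le_cos (x := k * l)
    have hx2 : (k * l) ^ 2 ≤ 1 := by nlinarith
    have hc2 : 1 / 4 ≤ Real.cos (k * l) ^ 2 := by nlinarith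
    have hD : 1 / 4 ≤ (1 - l ^ 2) * Real.cos (k * l) ^ 2 + l ^ 2 := by nlinarith
    have hN := mul_le_mul_of_nonneg_right hs (sq_nonneg (1 - l ^ 2))
    have hsq : (1 - l ^ 2) ^ 2 ≤ 1 := by nlinarith
    have hN2 : (k * l) ^ 2 * (1 - l ^ 2) ^ 2 ≤ (k * l) ^ 2 :=
      mul_le_of_le_one_right (sq_nonneg _) hsq
    have hR : 10 * k ^ 4 * (l ^ 2 * (1 / 4)) ≤
        10 * k ^ 4 * (l ^ 2 * ((1 - l ^ 2) * Real.cos (k * l) ^ 2 + l ^ 2)) := by gcongr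
    have hK : 3 + 3 / 4 * k ^ 2 ≤ 10 / 4 * k ^ 4 := by nlinarith
    have hKl := mul_le_mul_of_nonneg_right hK hlp.le
    have : 0 ≤ l ^ 4 := by positivity
    nlinarith
  · have hs : -1 ≤ Real.sin (2 * (k * l)) / (2 * (k * l)) := by
      rw [le_div_iff₀ (by positivity)]
      linarith [Real.neg_one_le_sin (2 * (k * l))]
    have hN := mul_le_mul_of_nonneg_right hs (sq_nonneg (1 - l ^ 2))
    have hx4 : 1 ≤ (k * l) ^ 4 := one_le_pow₀ h
    have hR : 10 * k ^ 4 * (l ^ 2 * l ^ 2) ≤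
        10 * k ^ 4 * (l ^ 2 * ((1 - l ^ 2) * Real.cos (k * l) ^ 2 + l ^ 2)) := by
      gcongr
      linarith
    nlinarith

theorem evanescent_mode_bound {k l : ℝ} (hk : 0 < k) (hl : 0 < l)
    (hμ : 12 / 5 ≤ k ^ 2 * (1 + l ^ 2)) :
    2 * ((1 + l ^ 2) ^ 2 * (Real.sinh (2 * k * l) / (2 * k * l)) + (l ^ 2 - 1))
        / (l ^ 2 * ((l ^ 2 + 1) * (Real.cosh (2 * k * l) - 1) + 2))
      ≤ 10 * max (k ^ 2) 1 := by
  have hlp : 0 < l ^ 2 := by positivity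
  have hx : 0 < k * l := by positivity
  have hcosh : 0 ≤ Real.cosh (2 * (k * l)) - 1 := by linarith [Real.one_le_cosh (2 * (k * l))]
  rw [mul_assoc 2 k l, div_le_iff₀ (by positivity)]
  rcases le_total (k * l) 1 with h | h
  · have hs := sinh_two_mul_div_le hx h
    have hx2 : (k * l) ^ 2 ≤ 1 := by nlinarith
    have hk2 : 7 / 5 ≤ k ^ 2 := by nlinarith
    have hl2 : l ^ 2 ≤ 5 / 7 := by nlinarith
    have hN := mul_le_mul_of_nonneg_left hs (sq_nonneg (1 + l ^ 2))
    have hR : 10 * k ^ 2 * (l ^ 2 * 2) ≤ 10 * max (k ^ 2) 1 *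
        (l ^ 2 * ((l ^ 2 + 1) * (Real.cosh (2 * (k * l)) - 1) + 2)) := by
      gcongr
      · exact le_max_left _ _
      · have : 0 ≤ (l ^ 2 + 1) * (Real.cosh (2 * (k * l)) - 1) := by positivity
        linarith
    have hsq : (1 + l ^ 2) ^ 2 ≤ 3 := by nlinarith
    have hN2 := mul_le_mul_of_nonneg_right hsq (sq_nonneg (k * l))
    have hl4 : (l ^ 2) ^ 2 ≤ 5 / 7 * l ^ 2 := by nlinarith
    have hKl := mul_le_mul_of_nonneg_right hk2 hlp.le
    nlinarith
  · set C := Real.cosh (2 * (k * l)) - 1 with hC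
    have hs : Real.sinh (2 * (k * l)) / (2 * (k * l)) ≤ C := by
      rw [div_le_iff₀ (by positivity)]
      nlinarith [sinh_two_mul_le_cosh_two_mul h]
    have hx2 : 1 ≤ k ^ 2 * l ^ 2 := by nlinarith
    have hN := mul_le_mul_of_nonneg_left hs (sq_nonneg (1 + l ^ 2))
    have hm1 := le_max_left (k ^ 2) 1
    have hm2 := le_max_right (k ^ 2) 1
    set M := max (k ^ 2) 1
    have hM : 1 + l ^ 2 ≤ 2 * M * l ^ 2 := by nlinarith
    have hp : 0 ≤ (1 + l ^ 2) * C := by positivity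
    have hN2 := mul_le_mul_of_nonneg_right hM hp
    have hMl : l ^ 2 ≤ M * l ^ 2 := by nlinarith
    have hq : 0 ≤ M * l ^ 2 * ((1 + l ^ 2) * C) := by positivity
    nlinarith

/-- Per-mode bounds `φₙ ≤ 10·max{k⁴,1}` (propagating) and `ψₙ ≤ 10·max{k²,1}`
(evanescent) for homogeneous impedance at the left side and inhomogeneous Neumann
datum at the right side. -/
theorem stmt_11 (k μ : ℝ) (hk : 0 < k)
    (hμ : ∃ n : ℕ, μ = (n : ℝ) * π ∨ μ = ((n : ℝ) + 1 / 2) * π) :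
    (∀ l : ℝ, μ < k → l = Real.sqrt (1 - μ ^ 2 / k ^ 2) →
      ((1 + l ^ 2) - (Real.sin (2 * k * l) / (2 * k * l)) * (1 - l ^ 2) ^ 2)
        / (l ^ 2 * ((1 - l ^ 2) * Real.cos (k * l) ^ 2 + l ^ 2))
      ≤ 10 * max (k ^ 4) 1)
    ∧ (∀ l : ℝ, k < μ → l = Real.sqrt (μ ^ 2 / k ^ 2 - 1) →
      2 * ((1 + l ^ 2) ^ 2 * (Real.sinh (2 * k * l) / (2 * k * l)) + (l ^ 2 - 1))
        / (l ^ 2 * ((l ^ 2 + 1) * (Real.cosh (2 * k * l) - 1) + 2))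
      ≤ 10 * max (k ^ 2) 1) := by
  obtain ⟨n, hn⟩ := hμ
  have hπ := Real.pi_gt_d2
  have hμ0 : 0 ≤ μ := by
    rcases hn with rfl | rfl <;> positivity
  have hμ_cases : μ = 0 ∨ 12 / 5 ≤ μ ^ 2 := by
    rcases hn with rfl | rfl
    · rcases Nat.eq_zero_or_pos n with rfl | h
      · simp
      · right
        have h1 : (1 : ℝ) ≤ n := by exact_mod_cast h
        have : π ≤ n * π := le_mul_of_one_le_left Real.pi_pos.le h1
        nlinarith
    · right
      have : 0 ≤ (n : ℝ) * π := by positivity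
      nlinarith
  constructor
  · rintro l hμk rfl
    have hpos : 0 < 1 - μ ^ 2 / k ^ 2 := by
      rw [sub_pos, div_lt_one (by positivity)]
      gcongr
    rcases hμ_cases with rfl | hμ2
    · have := le_max_right (k ^ 4) 1
      norm_num
      linarith
    · have hk2 : 2 ≤ k ^ 2 := by nlinarith
      have hl1 : √(1 - μ ^ 2 / k ^ 2) ≤ 1 := by
        rw [Real.sqrt_le_one]
        have : 0 ≤ μ ^ 2 / k ^ 2 := by positivity
        linarith
      refine (propagating_mode_bound hk hk2 (Real.sqrt_pos.2 hpos) hl1).trans ?_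
      gcongr
      exact le_max_left _ _
  · rintro l hkμ rfl
    have hpos : 0 < μ ^ 2 / k ^ 2 - 1 := by
      rw [sub_pos, one_lt_div (by positivity)]
      gcongr
    have hμ2 : 12 / 5 ≤ μ ^ 2 := hμ_cases.resolve_left (hk.trans hkμ).ne'
    refine evanescent_mode_bound hk (Real.sqrt_pos.2 hpos) ?_
    rw [Real.sq_sqrt hpos.le]
    field_simp
    linarith
end

section
/- Let n be a positive integer and set k := √(n²π² + π²/4). Define u : [0,1]² → ℝ by u(x,y) = −(2/π)·sin(πx/2)·√2·sin(nπy). Then: (i) Δu(x,y) + k²·u(x,y) = 0 for all (x,y) ∈ (0,1)²; (ii) u(x,0) = u(x,1) = 0 for all x ∈ [0,1]; (iii) ∂ₓu(1,y) = 0 for all y ∈ [0,1]; (iv) −∂ₓu(0,y) − i·k·u(0,y) = √2·sin(nπy) for all y ∈ [0,1]; and (v) ‖∇u‖_{0,Ω} + k·‖u‖_{0,Ω} = (2√2/π)·k, where Ω = (0,1)², ‖v‖_{0,Ω} := (∫_Ω |v|²)^{1/2} and ‖∇u‖_{0,Ω} := (∫_Ω |∂ₓu|² + |∂_y u|²)^{1/2}.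 -/
open scoped Real

lemma integral_sin_mul_sq_zero_one {a : ℝ} (ha : a ≠ 0) (h : Real.sin a * Real.cos a = 0) :
    ∫ x in (0 : ℝ)..1, Real.sin (a * x) ^ 2 = 1 / 2 := by
  rw [intervalIntegral.integral_comp_mul_left (fun x => Real.sin x ^ 2) ha, integral_sin_sq]
  simp [h]
  field_simp

lemma integral_cos_mul_sq_zero_one {a : ℝ} (ha : a ≠ 0) (h : Real.sin a * Real.cos a = 0) :
    ∫ x in (0 : ℝ)..1, Real.cos (a * x) ^ 2 = 1 / 2 := by
  rw [intervalIntegral.integral_comp_mul_left (fun x => Real.cos x ^ 2) ha, integral_cos_sq]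
  simp [mul_comm (Real.cos a), h]
  field_simp

lemma deriv_const_mul_sin_mul (c a : ℝ) :
    deriv (fun x : ℝ => c * Real.sin (a * x)) = fun x => c * a * Real.cos (a * x) := by
  funext x
  have h := (((hasDerivAt_id x).const_mul a).sin).const_mul c
  simp only [id, mul_one] at h
  rw [h.deriv]
  ring

lemma deriv_const_mul_cos_mul (c a : ℝ) :
    deriv (fun x : ℝ => c * Real.cos (a * x)) = fun x => -(c * a) * Real.sin (a * x) := by
  funext x
  have h := (((hasDerivAt_id x).const_mul a).cos).const_mul c
  simp only [id, mul_one] at h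
  rw [h.deriv]
  ring

/-- Sharpness example for the impedance–Neumann stability bound: the explicit
solution `u(x,y) = −(2/π)·sin(πx/2)·√2·sin(nπy)` with `k = √(n²π² + π²/4)`. -/
theorem stmt_17 (n : ℕ) (hn : 0 < n) (k : ℝ)
    (hk : k = Real.sqrt ((n : ℝ) ^ 2 * π ^ 2 + π ^ 2 / 4))
    (u : ℝ → ℝ → ℝ)
    (hu : ∀ x y : ℝ,
      u x y = -(2 / π) * Real.sin (π * x / 2) * (Real.sqrt 2 * Real.sin ((n : ℝ) * π * y))) :
    (∀ x ∈ Set.Ioo (0 : ℝ) 1, ∀ y ∈ Set.Ioo (0 : ℝ) 1,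
      deriv (deriv fun s => u s y) x + deriv (deriv fun t => u x t) y
        + k ^ 2 * u x y = 0)
    ∧ (∀ x ∈ Set.Icc (0 : ℝ) 1, u x 0 = 0 ∧ u x 1 = 0)
    ∧ (∀ y ∈ Set.Icc (0 : ℝ) 1, deriv (fun s => u s y) 1 = 0)
    ∧ (∀ y ∈ Set.Icc (0 : ℝ) 1,
        -((deriv (fun s => u s y) 0 : ℝ) : ℂ) - Complex.I * (k : ℂ) * ((u 0 y : ℝ) : ℂ)
          = ((Real.sqrt 2 * Real.sin ((n : ℝ) * π * y) : ℝ) : ℂ))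
    ∧ (Real.sqrt (∫ x in (0 : ℝ)..1, ∫ y in (0 : ℝ)..1,
          (deriv (fun s => u s y) x) ^ 2 + (deriv (fun t => u x t) y) ^ 2)
        + k * Real.sqrt (∫ x in (0 : ℝ)..1, ∫ y in (0 : ℝ)..1, (u x y) ^ 2)
        = (2 * Real.sqrt 2 / π) * k) := by
  have hπ := Real.pi_ne_zero
  have hn' : (n : ℝ) ≠ 0 := by exact_mod_cast hn.ne'
  have hb : (n : ℝ) * π ≠ 0 := mul_ne_zero hn' hπ
  have ha : π / 2 ≠ 0 := by positivity
  have h2 : Real.sqrt 2 ^ 2 = 2 := Real.sq_sqrt (by norm_num)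
  have hk0 : 0 ≤ k := hk ▸ Real.sqrt_nonneg _
  have hk2 : k ^ 2 = (n : ℝ) ^ 2 * π ^ 2 + π ^ 2 / 4 := by
    rw [hk, Real.sq_sqrt (by positivity)]
  have hsinb : Real.sin ((n : ℝ) * π) = 0 := Real.sin_nat_mul_pi n
  have hs : ∀ y, (fun s => u s y) = fun s =>
      (-(2 / π) * (Real.sqrt 2 * Real.sin ((n : ℝ) * π * y))) * Real.sin (π / 2 * s) := by
    intro y
    funext s
    rw [hu, show π * s / 2 = π / 2 * s by ring]
    ring
  have ht : ∀ x, (fun t => u x t) = fun t =>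
      (-(2 / π) * Real.sqrt 2 * Real.sin (π / 2 * x)) * Real.sin ((n : ℝ) * π * t) := by
    intro x
    funext t
    rw [hu, show π * x / 2 = π / 2 * x by ring]
    ring
  have hu' : ∀ x y, u x y =
      (-(2 / π) * Real.sqrt 2 * Real.sin (π / 2 * x)) * Real.sin ((n : ℝ) * π * y) :=
    fun x y => congrFun (ht x) y
  have hIa := integral_sin_mul_sq_zero_one ha (by simp)
  have hJa := integral_cos_mul_sq_zero_one ha (by simp)
  have hIb := integral_sin_mul_sq_zero_one hb (by simp [hsinb])
  have hJb := integral_cos_mul_sq_zero_one hb (by simp [hsinb])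
  refine ⟨?_, ?_, ?_, ?_, ?_⟩
  · intro x _ y _
    rw [hs, ht, deriv_const_mul_sin_mul, deriv_const_mul_sin_mul, deriv_const_mul_cos_mul,
      deriv_const_mul_cos_mul, hk2, hu']
    ring
  · intro x _
    simp [hu, hsinb]
  · intro y _
    rw [hs, deriv_const_mul_sin_mul]
    simp
  · intro y _
    rw [hs, deriv_const_mul_sin_mul, hu']
    simp only [mul_zero, Real.sin_zero, Real.cos_zero, zero_mul, Complex.ofReal_zero, sub_zero]
    rw [← Complex.ofReal_neg]
    congr 1
    field_simp
  · have hgrad : (∫ x in (0 : ℝ)..1, ∫ y in (0 : ℝ)..1,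
        (deriv (fun s => u s y) x) ^ 2 + (deriv (fun t => u x t) y) ^ 2)
          = (Real.sqrt 2 / π * k) ^ 2 := by
      have hin : ∀ x, (∫ y in (0 : ℝ)..1,
          (deriv (fun s => u s y) x) ^ 2 + (deriv (fun t => u x t) y) ^ 2)
            = Real.cos (π / 2 * x) ^ 2 + 4 * (n : ℝ) ^ 2 * Real.sin (π / 2 * x) ^ 2 := by
        intro x
        have hpt : ∀ y, (deriv (fun s => u s y) x) ^ 2 + (deriv (fun t => u x t) y) ^ 2
            = 2 * Real.cos (π / 2 * x) ^ 2 * Real.sin ((n : ℝ) * π * y) ^ 2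
              + 8 * (n : ℝ) ^ 2 * Real.sin (π / 2 * x) ^ 2 * Real.cos ((n : ℝ) * π * y) ^ 2 := by
          intro y
          rw [hs, ht, deriv_const_mul_sin_mul, deriv_const_mul_sin_mul]
          simp only [mul_pow, neg_sq, div_pow, h2]
          field_simp
          ring
        simp only [hpt]
        rw [intervalIntegral.integral_add (Continuous.intervalIntegrable (by fun_prop) _ _)
          (Continuous.intervalIntegrable (by fun_prop) _ _),
          intervalIntegral.integral_const_mul, intervalIntegral.integral_const_mul, hIb, hJb]
        ring
      simp only [hin]
      rw [intervalIntegral.integral_add (Continuous.intervalIntegrable (by fun_prop) _ _)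
        (Continuous.intervalIntegrable (by fun_prop) _ _),
        intervalIntegral.integral_const_mul, hIa, hJa, mul_pow, div_pow, h2, hk2]
      field_simp
      ring
    have hL2 : (∫ x in (0 : ℝ)..1, ∫ y in (0 : ℝ)..1, (u x y) ^ 2) = (Real.sqrt 2 / π) ^ 2 := by
      simp only [hu', mul_pow, neg_sq, div_pow, h2, intervalIntegral.integral_const_mul,
        intervalIntegral.integral_mul_const, hIa, hIb]
      ring
    rw [hgrad, hL2, Real.sqrt_sq (by positivity), Real.sqrt_sq (by positivity)]
    ring
end
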